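/- arXiv:0912.1046 — 2 statements merged into one kernel-verified Lean document; each statement's English description precedes it below -/
import Mathlib

section
/- (Euler–Jacobi–Kronecker formula) Let f₁, …, fₙ ∈ ℂ[x₁,…,xₙ] be non-constant polynomials such that: (i) the set Z := {d ∈ ℂⁿ : f₁(d) = ⋯ = fₙ(d) = 0} is finite; (ii) every point of Z is a simple zero, i.e. the Jacobian determinant det f′(d) := det(∂fᵢ/∂xⱼ(d)) is nonzero at each d ∈ Z; (iii) f₁, …, fₙ do not intersect at infinity, i.e. the top-degree homogeneous components f̂₁, …, f̂ₙ (where f̂ᵢ is the homogeneous part of fᵢ of degree deg fᵢ) have no common zero in ℂⁿ ∖ {0}. Then for every polynomial p ∈ ℂ[x₁,…,xₙ] with deg p ≤ (Σᵢ deg fᵢ) − (n+1), one has Σ_{d ∈ Z} p(d) / det f′(d) = 0. -/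
open MvPolynomial

section Grid

variable {K σ : Type*} [Field K] [DecidableEq K]

theorem Lagrange.sum_pow_div_derivative_nodal_eq_zero (S : Finset K) {k : ℕ}
    (hk : k + 1 < S.card) :
    ∑ a ∈ S, a ^ k / (Polynomial.derivative (Lagrange.nodal S id)).eval a = 0 := by
  have h := Lagrange.coeff_eq_sum (s := S) (v := id) (Set.injOn_id _)
    (P := (Polynomial.X ^ k : Polynomial K))
    (by rw [Polynomial.degree_X_pow]; exact_mod_cast (by omega : k < S.card))
  rw [Polynomial.coeff_X_pow, if_neg (by omega)] at h
  rw [h]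
  refine Finset.sum_congr rfl fun a ha => ?_
  have := Lagrange.eval_nodal_derivative_eval_node_eq (v := id) ha
  rw [id, Lagrange.eval_nodal] at this
  simp [this]

theorem Lagrange.eval_derivative_nodal_ne_zero {S : Finset K} {a : K} (ha : a ∈ S) :
    (Polynomial.derivative (Lagrange.nodal S id)).eval a ≠ 0 := by
  have := Lagrange.eval_nodal_derivative_eval_node_eq (v := id) ha
  rw [id, Lagrange.eval_nodal] at this
  rw [this, Finset.prod_ne_zero_iff]
  intro b hb
  exact sub_ne_zero.2 (Finset.ne_of_mem_erase hb).symm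

/-- The Euler–Jacobi formula for the grid `S × ⋯ × S`. -/
theorem MvPolynomial.sum_piFinset_eval_div_eq_zero [Fintype σ] [DecidableEq σ] (S : Finset K)
    (P : MvPolynomial σ K)
    (hP : P.totalDegree + Fintype.card σ < Fintype.card σ * S.card) :
    ∑ e ∈ Fintype.piFinset (fun _ : σ => S),
      eval e P / ∏ j, (Polynomial.derivative (Lagrange.nodal S id)).eval (e j) = 0 := by
  simp_rw [eval_eq', Finset.sum_div]
  rw [Finset.sum_comm]
  refine Finset.sum_eq_zero fun m hm => ?_
  simp_rw [mul_div_assoc, ← Finset.mul_sum, ← Finset.prod_div_distrib]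
  rw [← Finset.prod_univ_sum (fun _ : σ => S) (fun j a =>
    a ^ m j / (Polynomial.derivative (Lagrange.nodal S id)).eval a)]
  obtain ⟨j, hj⟩ : ∃ j, m j + 1 < S.card := by
    by_contra! h
    have h1 : ∑ j, m j ≤ P.totalDegree := by
      have := le_totalDegree hm
      rwa [Finsupp.sum_fintype _ _ (fun _ => rfl)] at this
    have h2 : ∑ _j : σ, S.card ≤ ∑ j, (m j + 1) := Finset.sum_le_sum fun j _ => h j
    rw [Finset.sum_add_distrib] at h2
    simp at h2
    omega
  rw [Finset.prod_eq_zero (Finset.mem_univ j)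
    (Lagrange.sum_pow_div_derivative_nodal_eq_zero S hj), mul_zero]

end Grid

section Univariate

variable {K σ : Type*} [Field K]

theorem MvPolynomial.pderiv_aeval_X [DecidableEq σ] (g : Polynomial K) (j k : σ) :
    pderiv k (Polynomial.aeval (X j : MvPolynomial σ K) g) =
      if j = k then Polynomial.aeval (X j) (Polynomial.derivative g) else 0 := by
  rw [Derivation.map_aeval, pderiv_X]
  by_cases h : j = k <;> simp [h]

theorem MvPolynomial.eval_aeval_X (g : Polynomial K) (j : σ) (e : σ → K) :
    eval e (Polynomial.aeval (X j : MvPolynomial σ K) g) = g.eval (e j) := by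
  rw [Polynomial.aeval_def, Polynomial.hom_eval₂, eval_X, MvPolynomial.algebraMap_eq,
    show (eval e).comp C = RingHom.id K from RingHom.ext fun a => by simp]
  rfl

theorem MvPolynomial.totalDegree_aeval_X_le (g : Polynomial K) (j : σ) :
    (Polynomial.aeval (X j : MvPolynomial σ K) g).totalDegree ≤ g.natDegree := by
  rw [Polynomial.aeval_eq_sum_range]
  refine totalDegree_finsetSum_le fun i hi => ?_
  refine (totalDegree_smul_le _ _).trans ?_
  rw [totalDegree_X_pow]
  exact Finset.mem_range_succ_iff.1 hi

end Univariate

section Radical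

variable {K σ : Type*} [Field K] [Fintype σ]

theorem MvPolynomial.exists_eq_sum_mul_X_sub_C (d : σ → K) (p : MvPolynomial σ K)
    (hp : eval d p = 0) : ∃ a : σ → MvPolynomial σ K, p = ∑ j, a j * (X j - C (d j)) := by
  set J : Ideal (MvPolynomial σ K) := Ideal.span (Set.range fun j => X j - C (d j)) with hJ
  have key : ∀ p : MvPolynomial σ K, p - C (eval d p) ∈ J := by
    intro p
    induction p using MvPolynomial.induction_on with
    | C a => simp
    | add p q hp hq =>
      have := J.add_mem hp hq
      convert this using 1
      simp only [map_add]; ring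
    | mul_X p j hp =>
      have h1 := J.mul_mem_right (X j) hp
      have h2 : C (eval d p) * (X j - C (d j)) ∈ J :=
        J.mul_mem_left _ (Ideal.subset_span ⟨j, rfl⟩)
      convert J.add_mem h1 h2 using 1
      simp only [map_mul, eval_X]; ring
  have h := key p
  rw [hp, map_zero, sub_zero, hJ, Ideal.mem_span_range_iff_exists_fun] at h
  obtain ⟨a, ha⟩ := h
  exact ⟨a, ha.symm⟩

variable [DecidableEq σ]

theorem MvPolynomial.exists_eval_ne_zero_mul_mem_span {f : σ → MvPolynomial σ K} {d : σ → K}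
    (hd : ∀ i, eval d (f i) = 0)
    (hsimple : (Matrix.of fun i j => eval d (pderiv j (f i))).det ≠ 0) :
    ∃ D : MvPolynomial σ K, eval d D ≠ 0 ∧
      ∀ p, eval d p = 0 → p * D ∈ Ideal.span (Set.range f) := by
  choose a ha using fun i => exists_eq_sum_mul_X_sub_C d (f i) (hd i)
  refine ⟨(Matrix.of a).det, ?_, fun p hp => ?_⟩
  · rw [RingHom.map_det]
    convert hsimple using 2
    ext i j
    conv_rhs => rw [Matrix.of_apply, ha i]
    simp [pderiv_X, Pi.single_apply, Derivation.leibniz, apply_ite]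
  · obtain ⟨c, rfl⟩ := exists_eq_sum_mul_X_sub_C d p hp
    rw [Finset.sum_mul]
    refine Ideal.sum_mem _ fun j _ => ?_
    rw [mul_assoc]
    refine Ideal.mul_mem_left _ _ ?_
    have h1 : (Matrix.of a).mulVec (fun j => X j - C (d j)) = f := by
      ext1 i
      rw [ha i]; rfl
    have h2 := congrArg (fun v => (Matrix.of a).adjugate.mulVec v j) h1
    simp only [Matrix.mulVec_mulVec, Matrix.adjugate_mul, Matrix.smul_mulVec,
      Matrix.one_mulVec, Pi.smul_apply, smul_eq_mul] at h2
    rw [mul_comm, h2]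
    exact Ideal.sum_mem _ fun i _ => Ideal.mul_mem_left _ _ (Ideal.subset_span ⟨i, rfl⟩)

/-- If all common zeros of `f` are simple, then the ideal generated by `f` is radical. -/
theorem MvPolynomial.mem_span_of_forall_eval_eq_zero [IsAlgClosed K] {f : σ → MvPolynomial σ K}
    (hsimple : ∀ d, (∀ i, eval d (f i) = 0) →
      (Matrix.of fun i j => eval d (pderiv j (f i))).det ≠ 0)
    {p : MvPolynomial σ K} (hp : ∀ d, (∀ i, eval d (f i) = 0) → eval d p = 0) :
    p ∈ Ideal.span (Set.range f) := by
  set I := Ideal.span (Set.range f)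
  set Q : Ideal (MvPolynomial σ K) := I.colon {p} with hQ
  have hmem : ∀ q, q ∈ Q ↔ q * p ∈ I := fun q => by
    rw [hQ, Submodule.mem_colon_singleton, smul_eq_mul]
  have hz : zeroLocus K Q = ∅ := by
    refine Set.eq_empty_of_forall_notMem fun d hd => ?_
    have hd0 : ∀ i, eval d (f i) = 0 := fun i => by
      have := hd (f i) ((hmem _).2 (I.mul_mem_right _ (Ideal.subset_span ⟨i, rfl⟩)))
      rwa [aeval_eq_eval] at this
    obtain ⟨D, hD, hD'⟩ := exists_eval_ne_zero_mul_mem_span hd0 (hsimple d hd0)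
    refine hD ?_
    have := hd D ((hmem _).2 (by rw [mul_comm]; exact hD' p (hp d hd0)))
    rwa [aeval_eq_eval] at this
  have h1 := vanishingIdeal_zeroLocus_eq_radical (K := K) Q
  rw [hz, vanishingIdeal_empty, eq_comm, Ideal.radical_eq_top] at h1
  simpa using (hmem 1).1 (h1 ▸ Submodule.mem_top)

end Radical

section Degree

variable {K σ : Type*} [Field K]

theorem MvPolynomial.homogeneousComponent_mul_of_isHomogeneous {g : MvPolynomial σ K} {d k : ℕ}
    (hg : g.IsHomogeneous d) (hdk : d ≤ k) (q : MvPolynomial σ K) :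
    homogeneousComponent k (q * g) = homogeneousComponent (k - d) q * g := by
  conv_lhs => rw [← sum_homogeneousComponent q, Finset.sum_mul, map_sum]
  have h : ∀ i ∈ Finset.range (q.totalDegree + 1),
      homogeneousComponent k (homogeneousComponent i q * g) =
        if k - d = i then homogeneousComponent (k - d) q * g else 0 := fun i _ => by
    rw [homogeneousComponent_of_mem ((homogeneousComponent_isHomogeneous i q).mul hg)]
    by_cases hi : k - d = i
    · rw [if_pos hi, if_pos (by omega), hi]
    · rw [if_neg hi, if_neg (by omega)]
  rw [Finset.sum_congr rfl h, Finset.sum_ite_eq]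
  split_ifs with hk
  · rfl
  · rw [homogeneousComponent_eq_zero _ _ (by rw [Finset.mem_range] at hk; omega), zero_mul]

theorem MvPolynomial.totalDegree_le_of_homogeneousComponent_eq_zero {p : MvPolynomial σ K}
    {k : ℕ} (hp : p.totalDegree ≤ k + 1) (h : homogeneousComponent (k + 1) p = 0) :
    p.totalDegree ≤ k := by
  refine Finset.sup_le fun m hm => ?_
  refine Nat.le_of_lt_succ (lt_of_le_of_ne ((le_totalDegree hm).trans hp) fun hmk => ?_)
  have := coeff_homogeneousComponent (k + 1) p m
  rw [h, coeff_zero, if_pos (show m.degree = k + 1 from hmk)] at this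
  exact (mem_support_iff.1 hm) this.symm

variable [Fintype σ]

/-- The polynomials `∑ i, q i * f i` with `deg (q i) ≤ k - deg (f i)` (truncated subtraction). -/
noncomputable def MvPolynomial.boundedSpan (f : σ → MvPolynomial σ K) (k : ℕ) :
    Submodule K (MvPolynomial σ K) :=
  (Submodule.pi Set.univ fun i => restrictTotalDegree σ K (k - (f i).totalDegree)).map
    ((Fintype.linearCombination (MvPolynomial σ K) f).restrictScalars K)

theorem MvPolynomial.mem_boundedSpan {f : σ → MvPolynomial σ K} {k : ℕ} {p : MvPolynomial σ K} :
    p ∈ boundedSpan f k ↔ ∃ q : σ → MvPolynomial σ K,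
      (∀ i, (q i).totalDegree ≤ k - (f i).totalDegree) ∧ ∑ i, q i * f i = p := by
  simp [boundedSpan, Submodule.mem_map, Submodule.mem_pi, mem_restrictTotalDegree,
    Fintype.linearCombination_apply]

theorem MvPolynomial.boundedSpan_mono (f : σ → MvPolynomial σ K) : Monotone (boundedSpan f) := by
  intro k l hkl p hp
  rw [mem_boundedSpan] at hp ⊢
  obtain ⟨q, hq, rfl⟩ := hp
  exact ⟨q, fun i => (hq i).trans (Nat.sub_le_sub_right hkl _), rfl⟩

theorem MvPolynomial.exists_mem_boundedSpan {f : σ → MvPolynomial σ K} {p : MvPolynomial σ K}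
    (hp : p ∈ Ideal.span (Set.range f)) : ∃ k, p ∈ boundedSpan f k := by
  obtain ⟨q, hq⟩ := Ideal.mem_span_range_iff_exists_fun.1 hp
  refine ⟨∑ i, ((q i).totalDegree + (f i).totalDegree), mem_boundedSpan.2 ⟨q, fun i => ?_, hq⟩⟩
  have := Finset.single_le_sum (f := fun i => (q i).totalDegree + (f i).totalDegree)
    (fun _ _ => Nat.zero_le _) (Finset.mem_univ i)
  omega

theorem MvPolynomial.boundedSpan_le_span (f : σ → MvPolynomial σ K) {k : ℕ}
    {p : MvPolynomial σ K} (hp : p ∈ boundedSpan f k) : p ∈ Ideal.span (Set.range f) := by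
  obtain ⟨q, -, hq⟩ := mem_boundedSpan.1 hp
  exact Ideal.mem_span_range_iff_exists_fun.2 ⟨q, hq⟩

theorem MvPolynomial.exists_idealOfVars_pow_le_span [IsAlgClosed K] (h : σ → MvPolynomial σ K)
    (hinf : ∀ d : σ → K, (∀ i, eval d (h i) = 0) → d = 0) :
    ∃ N, idealOfVars σ K ^ N ≤ Ideal.span (Set.range h) := by
  refine Ideal.exists_pow_le_of_le_radical_of_fg ?_ (idealOfVars_fg ..)
  rw [← vanishingIdeal_zeroLocus_eq_radical (K := K), zeroLocus_span, idealOfVars, Ideal.span_le]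
  rintro _ ⟨j, rfl⟩
  intro d hd
  have : d = 0 := hinf d fun i => by simpa [aeval_eq_eval] using hd (h i) ⟨i, rfl⟩
  simp [this]

/-- A polynomial of large degree can be reduced modulo `f` if the leading forms of `f` have no
nontrivial common zero. -/
theorem MvPolynomial.exists_sub_mem_boundedSpan [IsAlgClosed K] (f : σ → MvPolynomial σ K)
    (hinf : ∀ d : σ → K,
      (∀ i, eval d (homogeneousComponent (f i).totalDegree (f i)) = 0) → d = 0) :
    ∃ N, (∀ i, (f i).totalDegree ≤ N) ∧ ∀ k, N ≤ k → ∀ p : MvPolynomial σ K, p.totalDegree ≤ k →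
      ∃ r : MvPolynomial σ K, r.totalDegree ≤ N ∧ p - r ∈ boundedSpan f k := by
  obtain ⟨N, hN⟩ := exists_idealOfVars_pow_le_span _ hinf
  have hle : ∀ i, (f i).totalDegree ≤ N + ∑ i, (f i).totalDegree := fun i =>
    (Finset.single_le_sum (f := fun i => (f i).totalDegree)
      (fun _ _ => Nat.zero_le _) (Finset.mem_univ i)).trans (Nat.le_add_left _ _)
  refine ⟨N + ∑ i, (f i).totalDegree, hle, fun k hk => ?_⟩
  induction k, hk using Nat.le_induction with
  | base => exact fun p hp => ⟨p, hp, by rw [sub_self]; exact Submodule.zero_mem _⟩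
  | succ k hk ih =>
    intro p hp
    have hmem : homogeneousComponent (k + 1) p ∈
        Ideal.span (Set.range fun i => homogeneousComponent (f i).totalDegree (f i)) := by
      refine hN ((mem_pow_idealOfVars_iff' _ _).2 fun x hx => ?_)
      rw [coeff_homogeneousComponent, if_neg (by omega)]
    obtain ⟨q, hq⟩ := Ideal.mem_span_range_iff_exists_fun.1 hmem
    set c : σ → MvPolynomial σ K := fun i => homogeneousComponent (k + 1 - (f i).totalDegree) (q i)
    have hdeg : ∀ i, (f i).totalDegree ≤ k + 1 := fun i => (hle i).trans (by omega)
    have hc : ∀ i, (c i).totalDegree ≤ k + 1 - (f i).totalDegree := fun i =>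
      (homogeneousComponent_isHomogeneous _ _).totalDegree_le
    have hcf : ∀ i, homogeneousComponent (k + 1) (c i * f i) =
        c i * homogeneousComponent (f i).totalDegree (f i) := fun i => by
      have h1 := homogeneousComponent_mul_of_isHomogeneous
        (homogeneousComponent_isHomogeneous (k + 1 - (f i).totalDegree) (q i))
        (Nat.sub_le _ _) (f i)
      rw [mul_comm, h1, Nat.sub_sub_self (hdeg i), mul_comm]
    have hcomp : homogeneousComponent (k + 1) (p - ∑ i, c i * f i) = 0 := by
      have h2 := congrArg (homogeneousComponent (k + 1)) hq
      rw [map_sum, homogeneousComponent_eq_self (homogeneousComponent_isHomogeneous _ _)] at h2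
      rw [map_sub, map_sum, ← h2, sub_eq_zero]
      refine Finset.sum_congr rfl fun i _ => ?_
      rw [hcf, homogeneousComponent_mul_of_isHomogeneous
        (homogeneousComponent_isHomogeneous _ _) (hdeg i)]
    have hsum : (p - ∑ i, c i * f i).totalDegree ≤ k + 1 := by
      refine (totalDegree_sub _ _).trans (max_le hp (totalDegree_finsetSum_le fun i _ => ?_))
      refine (totalDegree_mul _ _).trans ?_
      have := hc i
      have := hdeg i
      omega
    obtain ⟨r, hr, hr'⟩ := ih _ (totalDegree_le_of_homogeneousComponent_eq_zero hsum hcomp)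
    refine ⟨r, hr, ?_⟩
    have h3 : ∑ i, c i * f i ∈ boundedSpan f (k + 1) := mem_boundedSpan.2 ⟨c, hc, rfl⟩
    convert add_mem (boundedSpan_mono f (Nat.le_succ k) hr') h3 using 1
    ring

theorem MvPolynomial.exists_forall_mem_boundedSpan [IsAlgClosed K] (f : σ → MvPolynomial σ K)
    (hinf : ∀ d : σ → K,
      (∀ i, eval d (homogeneousComponent (f i).totalDegree (f i)) = 0) → d = 0) :
    ∃ N, (∀ i, (f i).totalDegree ≤ N) ∧ ∀ k, N ≤ k → ∀ p ∈ Ideal.span (Set.range f),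
      p.totalDegree ≤ k → p ∈ boundedSpan f k := by
  obtain ⟨N, hN, hred⟩ := exists_sub_mem_boundedSpan f hinf
  set V : Submodule K (MvPolynomial σ K) :=
    restrictTotalDegree σ K N ⊓ (Ideal.span (Set.range f)).restrictScalars K
  have hV : V.FG := by
    have : FiniteDimensional K V :=
      Submodule.finiteDimensional_of_le (S₂ := restrictTotalDegree σ K N) inf_le_left
    exact (Submodule.fg_top _).1 this.1
  obtain ⟨M, hM⟩ : ∃ M, V ≤ boundedSpan f M := by
    obtain ⟨s, hs⟩ := hV
    have hsV : ∀ p ∈ s, ∃ k, p ∈ boundedSpan f k := fun p hp =>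
      exists_mem_boundedSpan (hs ▸ Submodule.subset_span hp : p ∈ V).2
    choose! k hk using hsV
    refine ⟨s.sup k, hs ▸ Submodule.span_le.2 fun p hp => ?_⟩
    exact boundedSpan_mono f (Finset.le_sup hp) (hk p hp)
  refine ⟨max N M, fun i => (hN i).trans (le_max_left _ _), fun k hk p hp hpk => ?_⟩
  obtain ⟨r, hr, hpr⟩ := hred k ((le_max_left _ _).trans hk) p hpk
  have hrI : r ∈ Ideal.span (Set.range f) := by
    simpa using Ideal.sub_mem _ hp (boundedSpan_le_span f hpr)
  have hrV : r ∈ V := ⟨(mem_restrictTotalDegree _ _ _).2 hr, hrI⟩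
  simpa using add_mem hpr (boundedSpan_mono f ((le_max_right _ _).trans hk) (hM hrV))

end Degree

section Transformation

variable {K σ : Type*} [Field K] [Fintype σ] [DecidableEq σ]

theorem MvPolynomial.totalDegree_det_add_le {M : Matrix σ σ (MvPolynomial σ K)} {d : σ → ℕ} {m : ℕ}
    (hd : ∀ i, d i ≤ m) (hM : ∀ j i, (M j i).totalDegree ≤ m - d i) :
    M.det.totalDegree + ∑ i, d i ≤ Fintype.card σ * m := by
  have h1 : M.det.totalDegree ≤ ∑ i, (m - d i) := by
    rw [Matrix.det_apply]
    refine totalDegree_finsetSum_le fun τ _ => ?_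
    rw [Units.smul_def, ← Int.cast_smul_eq_zsmul K]
    exact (totalDegree_smul_le _ _).trans ((totalDegree_finsetProd _ _).trans
      (Finset.sum_le_sum fun i _ => hM _ _))
  have h2 : ∑ i, (m - d i) + ∑ i, d i = Fintype.card σ * m := by
    rw [← Finset.sum_add_distrib, Finset.sum_congr rfl fun i _ => Nat.sub_add_cancel (hd i)]
    simp
  omega

/-- The Euler–Jacobi–Kronecker formula over an algebraically closed field. -/
theorem MvPolynomial.sum_eval_div_jacobian_eq_zero [IsAlgClosed K] (f : σ → MvPolynomial σ K)
    (Z : Finset (σ → K)) (hZ : ∀ d, d ∈ Z ↔ ∀ i, eval d (f i) = 0)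
    (hsimple : ∀ d ∈ Z, (Matrix.of fun i j => eval d (pderiv j (f i))).det ≠ 0)
    (hinf : ∀ d : σ → K,
      (∀ i, eval d (homogeneousComponent (f i).totalDegree (f i)) = 0) → d = 0)
    (p : MvPolynomial σ K)
    (hdeg : p.totalDegree + (Fintype.card σ + 1) ≤ ∑ i, (f i).totalDegree) :
    ∑ d ∈ Z, eval d p / (Matrix.of fun i j => eval d (pderiv j (f i))).det = 0 := by
  classical
  obtain ⟨N, hN, hred⟩ := exists_forall_mem_boundedSpan f hinf
  have : Infinite K := IsAlgClosed.instInfinite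
  set T : Finset K := Z.biUnion fun d => Finset.univ.image d
  obtain ⟨S, hTS, hS⟩ := Infinite.exists_superset_card_eq T (max N T.card) (le_max_right _ _)
  have hNS : N ≤ S.card := hS ▸ le_max_left _ _
  have hZS : ∀ d ∈ Z, ∀ j, d j ∈ S := fun d hd j =>
    hTS (Finset.mem_biUnion.2 ⟨d, hd, Finset.mem_image_of_mem _ (Finset.mem_univ j)⟩)
  set g : Polynomial K := Lagrange.nodal S id with hg
  have hgS : ∀ a ∈ S, g.eval a = 0 := fun a ha => Lagrange.eval_nodal_at_node (v := id) ha
  have hmem : ∀ j, Polynomial.aeval (X j : MvPolynomial σ K) g ∈ boundedSpan f S.card := by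
    intro j
    refine hred _ hNS _ (mem_span_of_forall_eval_eq_zero (fun d hd => hsimple d ((hZ d).2 hd))
      fun d hd => ?_) ((totalDegree_aeval_X_le _ _).trans (Lagrange.natDegree_nodal).le)
    rw [eval_aeval_X, hgS _ (hZS d ((hZ d).2 hd) j)]
  choose q hq hqg using fun j => mem_boundedSpan.1 (hmem j)
  set M : Matrix σ σ (MvPolynomial σ K) := Matrix.of q
  have hMdeg : M.det.totalDegree + ∑ i, (f i).totalDegree ≤ Fintype.card σ * S.card :=
    totalDegree_det_add_le (fun i => (hN i).trans hNS) hq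
  have hgrid := sum_piFinset_eval_div_eq_zero S (p * M.det) (by
    have := totalDegree_mul p M.det
    omega)
  rw [← hgrid, ← hg]
  have hsub : Z ⊆ Fintype.piFinset fun _ : σ => S := fun d hd =>
    Fintype.mem_piFinset.2 (hZS d hd)
  have hzero : ∀ e ∈ Fintype.piFinset (fun _ : σ => S), e ∉ Z →
      eval e (p * M.det) / ∏ j, (Polynomial.derivative g).eval (e j) = 0 := by
    intro e he heZ
    have hdet : ((eval e).mapMatrix M).det = 0 := by
      refine Matrix.exists_mulVec_eq_zero_iff.1 ⟨fun i => eval e (f i), fun h => ?_, ?_⟩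
      · exact heZ ((hZ e).2 fun i => congrFun h i)
      · ext1 j
        have := congrArg (eval e) (hqg j)
        rw [eval_aeval_X, hgS _ (Fintype.mem_piFinset.1 he j), map_sum] at this
        simpa [Matrix.mulVec, dotProduct, M] using this
    rw [map_mul, RingHom.map_det, hdet, mul_zero, zero_div]
  rw [← Finset.sum_subset hsub hzero]
  refine Finset.sum_congr rfl fun d hd => ?_
  have hchain : (eval d).mapMatrix M * (Matrix.of fun i j => eval d (pderiv j (f i))) =
      Matrix.diagonal fun j => (Polynomial.derivative g).eval (d j) := by
    ext j k
    have := congrArg (fun r => eval d (pderiv k r)) (hqg j)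
    simp only [pderiv_aeval_X, map_sum, Derivation.leibniz, map_add, smul_eq_mul, map_mul,
      (hZ d).1 hd, zero_mul, add_zero, apply_ite (eval d), eval_aeval_X, map_zero] at this
    rw [Matrix.diagonal_apply, Matrix.mul_apply, ← this]
    rfl
  have hdet := congrArg Matrix.det hchain
  rw [Matrix.det_mul, Matrix.det_diagonal] at hdet
  have hne : ∏ j, (Polynomial.derivative g).eval (d j) ≠ 0 :=
    Finset.prod_ne_zero_iff.2 fun j _ => Lagrange.eval_derivative_nodal_ne_zero (hZS d hd j)
  rw [map_mul, RingHom.map_det, div_eq_div_iff (hsimple d hd) hne, ← hdet]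
  ring

end Transformation

/-- The Euler–Jacobi–Kronecker formula: if `f₁, …, fₙ ∈ ℂ[x₁,…,xₙ]` are non-constant
polynomials with finitely many common zeros, all of them simple (nonvanishing Jacobian
determinant), and whose top-degree homogeneous components have no common zero except `0`
(no intersection at infinity), then for every polynomial `p` with
`deg p ≤ Σᵢ deg fᵢ − (n+1)` the sum of `p/det f'` over the common zeros vanishes. -/
theorem stmt9 {n : ℕ} (f : Fin n → MvPolynomial (Fin n) ℂ)
    (hfc : ∀ i, 0 < (f i).totalDegree)
    (Z : Set (Fin n → ℂ)) (hZdef : Z = {d | ∀ i, eval d (f i) = 0})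
    (hZfin : Z.Finite)
    (hsimple : ∀ d ∈ Z,
      Matrix.det (Matrix.of fun i j => eval d (pderiv j (f i))) ≠ 0)
    (hinf : ∀ d : Fin n → ℂ,
      (∀ i, eval d (homogeneousComponent (f i).totalDegree (f i)) = 0) → d = 0)
    (p : MvPolynomial (Fin n) ℂ)
    (hdeg : p.totalDegree + (n + 1) ≤ ∑ i, (f i).totalDegree) :
    ∑ d ∈ hZfin.toFinset,
        eval d p / Matrix.det (Matrix.of fun i j => eval d (pderiv j (f i))) = 0 := by
  subst hZdef
  exact sum_eval_div_jacobian_eq_zero f hZfin.toFinset (fun d => hZfin.mem_toFinset)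
    (fun d hd => hsimple d (hZfin.mem_toFinset.1 hd)) hinf p (by rwa [Fintype.card_fin])
end

section
/- Let n ≥ 2, k > 2, and let V ∈ ℂ[q₁,…,qₙ] be a homogeneous polynomial of degree k such that all Darboux points of V are proper and simple, i.e.: (i) V′(d) = 0 with d ∈ ℂⁿ implies d = 0; (ii) for every d in the (then finite) set S := {d ∈ ℂⁿ ∖ {0} : V′(d) = d}, det(V″(d) − 1) ≠ 0. For d ∈ S, let Λ(d) = (Λ₁(d),…,Λ_{n−1}(d)) be the multiset of roots of the characteristic polynomial of V″(d) − 1 with one copy of the trivial root k−2 removed. Then for every r = 0, 1, …, n−1: Σ_{d ∈ S} τ₁(Λ(d))^r / τ_{n−1}(Λ(d)) = (k−2)·(−1)^{n−1}·(−n−(k−2))^r. (Each projective Darboux point [d] ∈ ℙ^{n−1} has exactly k−2 normalized representatives in S, all with identical Hessian, so dividing by k−2 gives the relation Σ_{[d]∈𝒟(V)} τ₁(Λ(d))^r / τ_{n−1}(Λ(d)) = (−1)^{n−1}(−n−(k−2))^r over the set 𝒟(V) of projective Darboux points.) -/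
open MvPolynomial

/-- The gradient of a multivariate polynomial, evaluated at a point. -/
noncomputable def grad {n : ℕ} (V : MvPolynomial (Fin n) ℂ) (d : Fin n → ℂ) : Fin n → ℂ :=
  fun i => eval d (pderiv i V)

/-- The Hessian matrix of a multivariate polynomial, evaluated at a point. -/
noncomputable def hess {n : ℕ} (V : MvPolynomial (Fin n) ℂ) (d : Fin n → ℂ) :
    Matrix (Fin n) (Fin n) ℂ :=
  Matrix.of fun i j => eval d (pderiv i (pderiv j V))

/-- The multiset `Λ(d)` of shifted nontrivial eigenvalues at a normalized proper Darboux
point: the roots of the characteristic polynomial of `V''(d) − 1` (counted with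
multiplicity) with one copy of the trivial root `k−2` removed. -/
noncomputable def shiftedSpectrum {n : ℕ} (k : ℕ) (V : MvPolynomial (Fin n) ℂ)
    (d : Fin n → ℂ) : Multiset ℂ :=
  ((hess V d - 1).charpoly.roots).erase ((k : ℂ) - 2)

namespace MvPolynomial

variable {σ K : Type*} [Fintype σ] [Field K]

/-- Polynomials of the form `∑ j, a j * F j` with all `a j` of total degree at most `e`. -/
noncomputable def boundedCombination (F : σ → MvPolynomial σ K) (e : ℕ) :
    Submodule K (MvPolynomial σ K) :=
  (Submodule.pi Set.univ fun _ => restrictTotalDegree σ K e).map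
    ((Fintype.linearCombination (MvPolynomial σ K) F).restrictScalars K)

theorem mem_boundedCombination {F : σ → MvPolynomial σ K} {e : ℕ} {f : MvPolynomial σ K} :
    f ∈ boundedCombination F e ↔
      ∃ a : σ → MvPolynomial σ K, (∀ j, (a j).totalDegree ≤ e) ∧ ∑ j, a j * F j = f := by
  simp [boundedCombination, Submodule.mem_map, Submodule.mem_pi, mem_restrictTotalDegree,
    Fintype.linearCombination_apply]

theorem boundedCombination_mono (F : σ → MvPolynomial σ K) : Monotone (boundedCombination F) := by
  intro e e' h f hf
  obtain ⟨a, ha, rfl⟩ := mem_boundedCombination.1 hf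
  exact mem_boundedCombination.2 ⟨a, fun j => (ha j).trans h, rfl⟩

theorem mem_span_of_mem_boundedCombination {F : σ → MvPolynomial σ K} {e : ℕ}
    {f : MvPolynomial σ K} (hf : f ∈ boundedCombination F e) : f ∈ Ideal.span (Set.range F) := by
  obtain ⟨a, -, rfl⟩ := mem_boundedCombination.1 hf
  exact Ideal.mem_span_range_iff_exists_fun.2 ⟨a, rfl⟩

theorem exists_mem_boundedCombination {F : σ → MvPolynomial σ K} {f : MvPolynomial σ K}
    (hf : f ∈ Ideal.span (Set.range F)) : ∃ e, f ∈ boundedCombination F e := by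
  obtain ⟨a, rfl⟩ := Ideal.mem_span_range_iff_exists_fun.1 hf
  exact ⟨Finset.univ.sup fun j => (a j).totalDegree, mem_boundedCombination.2
    ⟨a, fun j => Finset.le_sup (f := fun j => (a j).totalDegree) (Finset.mem_univ j), rfl⟩⟩

omit [Fintype σ] in
theorem IsHomogeneous.mem_span_X_pow {f : MvPolynomial σ K} {d : ℕ} (hf : f.IsHomogeneous d) :
    f ∈ Ideal.span (Set.range (X : σ → MvPolynomial σ K)) ^ d := by
  rw [f.as_sum]
  refine Ideal.sum_mem _ fun s hs => ?_
  have hd : s.degree = d := by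
    have := hf (mem_support_iff.1 hs)
    rwa [Pi.one_def, ← Finsupp.degree_eq_weight_one] at this
  rw [monomial_eq]
  refine Ideal.mul_mem_left _ _ ?_
  rw [← hd, Finsupp.degree_apply, ← Finset.prod_pow_eq_pow_sum]
  exact Ideal.prod_mem_prod fun i _ =>
    Ideal.pow_mem_pow (Ideal.subset_span (Set.mem_range_self i)) _

omit [Fintype σ] in
theorem IsHomogeneous.homogeneousComponent_mul {L : MvPolynomial σ K} {m : ℕ}
    (hL : L.IsHomogeneous m) (c : MvPolynomial σ K) (e : ℕ) :
    homogeneousComponent (e + m) (c * L) = homogeneousComponent e c * L := by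
  conv_lhs => rw [← sum_homogeneousComponent c, Finset.sum_mul, map_sum]
  have h : ∀ i, homogeneousComponent (e + m) (homogeneousComponent i c * L) =
      if e = i then homogeneousComponent i c * L else 0 := by
    intro i
    rw [homogeneousComponent_of_mem (m := e + m) (n := i + m)
      ((homogeneousComponent_isHomogeneous i c).mul hL)]
    simp
  simp_rw [h, Finset.sum_ite_eq]
  split_ifs with he
  · rfl
  · rw [homogeneousComponent_eq_zero, zero_mul]
    simpa [Nat.lt_succ_iff] using he

theorem exists_forall_isHomogeneous_mem_boundedCombination [IsAlgClosed K]
    {L : σ → MvPolynomial σ K} {m : ℕ} (hL : ∀ j, (L j).IsHomogeneous m)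
    (h0 : ∀ x : σ → K, (∀ j, eval x (L j) = 0) → x = 0) :
    ∃ E, m ≤ E ∧ ∀ d, E ≤ d → ∀ f : MvPolynomial σ K, f.IsHomogeneous d →
      f ∈ boundedCombination L (d - m) := by
  set I := Ideal.span (Set.range L)
  have hX : Ideal.span (Set.range (X : σ → MvPolynomial σ K)) ≤ I.radical := by
    rw [← vanishingIdeal_zeroLocus_eq_radical (K := K), Ideal.span_le]
    rintro _ ⟨i, rfl⟩
    rw [SetLike.mem_coe, mem_vanishingIdeal_iff]
    intro x hx
    have : x = 0 := h0 x fun j => by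
      have := hx (L j) (Ideal.subset_span (Set.mem_range_self j))
      rwa [aeval_eq_eval] at this
    simp [this]
  obtain ⟨N, hN⟩ := Ideal.exists_radical_pow_le_of_fg I (IsNoetherian.noetherian _)
  refine ⟨N + m, Nat.le_add_left _ _, fun d hd f hf => ?_⟩
  have hfI : f ∈ I := hN (Ideal.pow_right_mono hX N
    (Ideal.pow_le_pow_right ((Nat.le_add_right _ _).trans hd) hf.mem_span_X_pow))
  obtain ⟨c, hc⟩ := Ideal.mem_span_range_iff_exists_fun.1 hfI
  refine mem_boundedCombination.2 ⟨fun j => homogeneousComponent (d - m) (c j), fun j =>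
    (homogeneousComponent_isHomogeneous _ _).totalDegree_le, ?_⟩
  have hdm : d - m + m = d := by omega
  simp_rw [← (hL _).homogeneousComponent_mul, ← map_sum, hc, hdm]
  exact homogeneousComponent_eq_self hf

theorem exists_forall_sub_mem_boundedCombination [IsAlgClosed K]
    {L F : σ → MvPolynomial σ K} {m : ℕ} (hL : ∀ j, (L j).IsHomogeneous m)
    (h0 : ∀ x : σ → K, (∀ j, eval x (L j) = 0) → x = 0)
    (hF : ∀ j, (L j - F j).totalDegree < m) :
    ∃ E, ∀ e, ∀ f : MvPolynomial σ K, f.totalDegree ≤ E + e →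
      ∃ r, r.totalDegree ≤ E ∧ f - r ∈ boundedCombination F (E + e - m) := by
  obtain ⟨E, hmE, hE⟩ := exists_forall_isHomogeneous_mem_boundedCombination hL h0
  refine ⟨E, fun e => ?_⟩
  induction e with
  | zero => exact fun f hf => ⟨f, hf, by simp⟩
  | succ e ih =>
    intro f hf
    obtain ⟨a, ha, hsum⟩ := mem_boundedCombination.1
      (hE (E + (e + 1)) (by omega) _ (homogeneousComponent_isHomogeneous (E + (e + 1)) f))
    have hlow : (f - homogeneousComponent (E + (e + 1)) f).totalDegree ≤ E + e := by
      refine Finset.sup_le fun s hs => ?_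
      rw [mem_support_iff, coeff_sub, coeff_homogeneousComponent] at hs
      split_ifs at hs with hsd
      · simp at hs
      · rw [sub_zero] at hs
        have hle := (le_totalDegree (mem_support_iff.2 hs)).trans hf
        have hsum : s.degree = s.sum fun _ e => e := rfl
        omega
    have hdeg : (f - ∑ j, a j * F j).totalDegree ≤ E + e := by
      have : f - ∑ j, a j * F j = (f - homogeneousComponent (E + (e + 1)) f) +
          ∑ j, a j * (L j - F j) := by
        rw [← hsum]; simp only [mul_sub, Finset.sum_sub_distrib]; ring
      rw [this]
      refine (totalDegree_add _ _).trans (max_le hlow (totalDegree_finsetSum_le fun j _ =>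
        (totalDegree_mul _ _).trans ?_))
      have := ha j
      have := hF j
      omega
    obtain ⟨r, hr, hmem⟩ := ih _ hdeg
    refine ⟨r, hr, ?_⟩
    have : f - r = (f - ∑ j, a j * F j - r) + ∑ j, a j * F j := by ring
    rw [this]
    exact add_mem (boundedCombination_mono F (by omega) hmem)
      (mem_boundedCombination.2 ⟨a, ha, rfl⟩)

theorem exists_forall_mem_span_mem_boundedCombination [IsAlgClosed K]
    {L F : σ → MvPolynomial σ K} {m : ℕ} (hL : ∀ j, (L j).IsHomogeneous m)
    (h0 : ∀ x : σ → K, (∀ j, eval x (L j) = 0) → x = 0)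
    (hF : ∀ j, (L j - F j).totalDegree < m) :
    ∃ s, ∀ d, s ≤ d → ∀ f ∈ Ideal.span (Set.range F), f.totalDegree ≤ d →
      f ∈ boundedCombination F (d - m) := by
  obtain ⟨E, hE⟩ := exists_forall_sub_mem_boundedCombination hL h0 hF
  have hlow : ∃ s, (Ideal.span (Set.range F)).restrictScalars K ⊓ restrictTotalDegree σ K E ≤
      boundedCombination F s := by
    have hfg : ((Ideal.span (Set.range F)).restrictScalars K ⊓ restrictTotalDegree σ K E).FG :=
      Submodule.FG.of_le_of_isNoetherian inf_le_right
    obtain ⟨t, ht⟩ := hfg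
    choose! e he using fun f (hf : f ∈ Ideal.span (Set.range F)) =>
      exists_mem_boundedCombination hf
    refine ⟨t.sup e, ?_⟩
    rw [← ht, Submodule.span_le]
    intro f hf
    have hfI : f ∈ Ideal.span (Set.range F) := by
      have : f ∈ (Ideal.span (Set.range F)).restrictScalars K ⊓ restrictTotalDegree σ K E :=
        ht ▸ Submodule.subset_span hf
      exact this.1
    exact boundedCombination_mono F (Finset.le_sup hf) (he f hfI)
  obtain ⟨s, hs⟩ := hlow
  refine ⟨E + s + m, fun d hd f hf hfd => ?_⟩
  obtain ⟨r, hr, hfr⟩ := hE (d - E) f (by omega)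
  rw [show E + (d - E) = d by omega] at hfr
  have hrI : r ∈ Ideal.span (Set.range F) := by
    simpa using sub_mem hf (mem_span_of_mem_boundedCombination hfr)
  have := boundedCombination_mono F (show s ≤ d - m by omega)
    (hs ⟨hrI, (mem_restrictTotalDegree _ _ _).2 hr⟩)
  simpa using add_mem hfr this

theorem exists_sub_C_eval_eq_sum (z : σ → K) (f : MvPolynomial σ K) :
    ∃ b : σ → MvPolynomial σ K, f - C (eval z f) = ∑ j, b j * (X j - C (z j)) ∧
      ∀ j, eval z (b j) = eval z (pderiv j f) := by
  classical
  induction f using MvPolynomial.induction_on with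
  | C a => exact ⟨0, by simp⟩
  | add p q hp hq =>
    obtain ⟨b, hb, hb'⟩ := hp
    obtain ⟨c, hc, hc'⟩ := hq
    refine ⟨b + c, ?_, fun j => by simp [hb', hc']⟩
    simp only [Pi.add_apply, add_mul, Finset.sum_add_distrib, ← hb, ← hc, map_add]
    ring
  | mul_X p i hp =>
    obtain ⟨b, hb, hb'⟩ := hp
    refine ⟨fun j => b j * X i + Pi.single (M := fun _ => MvPolynomial σ K) i (C (eval z p)) j,
      ?_, fun j => ?_⟩
    · have : ∑ j, Pi.single (M := fun _ => MvPolynomial σ K) i (C (eval z p)) j *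
          (X j - C (z j)) = C (eval z p) * (X i - C (z i)) := by
        rw [Finset.sum_eq_single i] <;> simp +contextual
      simp only [add_mul, Finset.sum_add_distrib, this, mul_right_comm _ (X i), ← Finset.sum_mul,
        ← hb, map_mul, eval_X]
      ring
    · rw [Derivation.leibniz, pderiv_X]
      rcases eq_or_ne j i with rfl | h
      · simp [hb']; ring
      · simp [hb', Pi.single_eq_of_ne h, Pi.single_eq_of_ne h.symm]; ring

/-- The Jacobian matrix of a family of polynomials, evaluated at a point. -/
noncomputable def jacobianAt (F : σ → MvPolynomial σ K) (z : σ → K) : Matrix σ σ K :=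
  Matrix.of fun i j => eval z (pderiv j (F i))

theorem mem_span_of_forall_eval_eq_zero_s10 [DecidableEq σ] [IsAlgClosed K]
    {F : σ → MvPolynomial σ K}
    (hF : ∀ z : σ → K, (∀ j, eval z (F j) = 0) → (jacobianAt F z).det ≠ 0)
    {f : MvPolynomial σ K} (hf : ∀ z : σ → K, (∀ j, eval z (F j) = 0) → eval z f = 0) :
    f ∈ Ideal.span (Set.range F) := by
  by_contra hfI
  set I := Ideal.span (Set.range F) with hI
  let Q : Ideal (MvPolynomial σ K) :=
    Submodule.comap (LinearMap.mulRight (MvPolynomial σ K) f) I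
  have hQ : ∀ u, u ∈ Q ↔ u * f ∈ I := fun u => Iff.rfl
  have hQtop : Q ≠ ⊤ := fun h => hfI (by simpa [hQ] using (Ideal.eq_top_iff_one Q).1 h)
  obtain ⟨M, hM, hQM⟩ := Ideal.exists_le_maximal Q hQtop
  obtain ⟨z, rfl⟩ := eq_vanishingIdeal_singleton_of_isMaximal K hM
  have hev : ∀ u ∈ Q, eval z u = 0 := fun u hu => by
    have := (mem_vanishingIdeal_singleton_iff z u).1 (hQM hu)
    rwa [aeval_eq_eval] at this
  have hz : ∀ j, eval z (F j) = 0 := fun j => hev _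
    ((hQ _).2 (Ideal.mul_mem_right _ _ (Ideal.subset_span (Set.mem_range_self j))))
  choose b hb hbz using fun i => exists_sub_C_eval_eq_sum z (F i)
  simp only [hz, map_zero, sub_zero] at hb
  let B : Matrix σ σ (MvPolynomial σ K) := Matrix.of b
  have hBF : B.mulVec (fun j => X j - C (z j)) = F := by
    funext i
    simp [B, Matrix.mulVec, dotProduct, hb i]
  have hdetX : ∀ j, B.det * (X j - C (z j)) ∈ I := fun j => by
    have h := congrArg (fun v => B.adjugate.mulVec v j) hBF
    simp only [Matrix.mulVec_mulVec, Matrix.adjugate_mul, Matrix.smul_mulVec, Matrix.one_mulVec,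
      Pi.smul_apply, smul_eq_mul] at h
    rw [h]
    exact Ideal.sum_mem _ fun i _ =>
      Ideal.mul_mem_left _ _ (Ideal.subset_span (Set.mem_range_self i))
  obtain ⟨c, hc, -⟩ := exists_sub_C_eval_eq_sum z f
  rw [hf z hz, map_zero, sub_zero] at hc
  have hdetQ : B.det ∈ Q := by
    rw [hQ, hc, Finset.mul_sum]
    refine Ideal.sum_mem _ fun j _ => ?_
    rw [mul_left_comm]
    exact Ideal.mul_mem_left _ _ (hdetX j)
  refine hF z hz ?_
  rw [← hev _ hdetQ, RingHom.map_det]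
  congr 1
  ext i j
  simp [B, jacobianAt, hbz]

theorem totalDegree_det_le [DecidableEq σ] {A : Matrix σ σ (MvPolynomial σ K)} {e : ℕ}
    (hA : ∀ i j, (A i j).totalDegree ≤ e) : A.det.totalDegree ≤ Fintype.card σ * e := by
  rw [Matrix.det_apply]
  refine totalDegree_finsetSum_le fun τ _ => (totalDegree_smul_le _ _).trans ?_
  refine (totalDegree_finsetProd _ _).trans ((Finset.sum_le_card_nsmul _ _ e fun i _ =>
    hA _ _).trans ?_)
  simp

theorem sum_piFinset_eval_div_eq_zero_s10 [DecidableEq σ] [DecidableEq K] (T : Finset K)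
    {h : MvPolynomial σ K} (hh : h.totalDegree < Fintype.card σ * (T.card - 1)) :
    ∑ x ∈ Fintype.piFinset (fun _ : σ => T),
      eval x h / ∏ i, ∏ t ∈ T.erase (x i), (x i - t) = 0 := by
  have hmono : ∀ α ∈ h.support, ∑ x ∈ Fintype.piFinset (fun _ : σ => T),
      (∏ i, x i ^ α i) / ∏ i, ∏ t ∈ T.erase (x i), (x i - t) = 0 := by
    intro α hα
    simp_rw [← Finset.prod_div_distrib]
    rw [← Finset.prod_univ_sum (fun _ : σ => T)
      (fun i s => s ^ α i / ∏ t ∈ T.erase s, (s - t))]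
    obtain ⟨i, hi⟩ : ∃ i, α i < T.card - 1 := by
      by_contra! hcon
      have h1 := le_totalDegree hα
      rw [Finsupp.sum_fintype _ _ (fun _ => rfl)] at h1
      have h2 := Finset.card_nsmul_le_sum Finset.univ α _ fun i _ => hcon i
      rw [Finset.card_univ, smul_eq_mul] at h2
      exact absurd (h2.trans h1) hh.not_ge
    refine Finset.prod_eq_zero (Finset.mem_univ i) ?_
    have hdeg : (Polynomial.X ^ α i : Polynomial K).degree < T.card := by
      rw [Polynomial.degree_X_pow]
      exact_mod_cast (by omega : α i < T.card)
    have := Lagrange.coeff_eq_sum (s := T) (v := id) Function.injective_id.injOn hdeg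
    simpa [Polynomial.coeff_X_pow, hi.ne'] using this.symm
  simp_rw [eval_eq', Finset.sum_div, mul_div_assoc]
  rw [Finset.sum_comm]
  refine Finset.sum_eq_zero fun α hα => ?_
  rw [← Finset.mul_sum, hmono α hα, mul_zero]

/-- The Euler–Jacobi vanishing theorem for affine complete intersections without zeros
at infinity and with only simple zeros. -/
theorem sum_eval_div_det_jacobianAt_eq_zero [DecidableEq σ] [IsAlgClosed K]
    {L F : σ → MvPolynomial σ K} {m : ℕ} (hL : ∀ j, (L j).IsHomogeneous m)
    (h0 : ∀ x : σ → K, (∀ j, eval x (L j) = 0) → x = 0)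
    (hF : ∀ j, (L j - F j).totalDegree < m)
    {Z : Finset (σ → K)} (hZ : ∀ z, z ∈ Z ↔ ∀ j, eval z (F j) = 0)
    (hsimple : ∀ z ∈ Z, (jacobianAt F z).det ≠ 0)
    {g : MvPolynomial σ K} (hg : g.totalDegree < Fintype.card σ * (m - 1)) :
    ∑ z ∈ Z, eval z g / (jacobianAt F z).det = 0 := by
  classical
  obtain ⟨s, hs⟩ := exists_forall_mem_span_mem_boundedCombination hL h0 hF
  have : Infinite K := IsAlgClosed.instInfinite
  obtain ⟨T, hZT, hsT⟩ : ∃ T : Finset K, (∀ z ∈ Z, ∀ i, z i ∈ T) ∧ s + m ≤ T.card := by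
    obtain ⟨T, hT, hcard⟩ := Infinite.exists_superset_card_eq
      (Z.biUnion fun z => Finset.univ.image z) _ (Nat.le_add_right _ (s + m))
    exact ⟨T, fun z hz i => hT (Finset.mem_biUnion.2
      ⟨z, hz, Finset.mem_image_of_mem _ (Finset.mem_univ i)⟩), by omega⟩
  let p : Polynomial K := Lagrange.nodal T id
  let P : σ → MvPolynomial σ K := fun i => Polynomial.aeval (X i) p
  have hPeval : ∀ x i, eval x (P i) = p.eval (x i) := fun x i => by
    rw [← aeval_eq_eval, ← Polynomial.aeval_algHom_apply]
    simp
  have hP0 : ∀ x i, x i ∈ T → eval x (P i) = 0 := fun x i hx => by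
    rw [hPeval]
    exact Lagrange.eval_nodal_at_node (v := id) hx
  have hPdeg : ∀ i, (P i).totalDegree ≤ T.card := fun i => by
    simp only [P, p, Lagrange.nodal, map_prod, map_sub, Polynomial.aeval_X, Polynomial.aeval_C]
    refine (totalDegree_finsetProd _ _).trans
      ((Finset.sum_le_card_nsmul _ _ 1 fun t _ => ?_).trans (by simp))
    exact (totalDegree_sub_C_le _ _).trans (totalDegree_X _).le
  have hPI : ∀ i, P i ∈ boundedCombination F (T.card - m) := fun i =>
    hs _ (by omega) _ (mem_span_of_forall_eval_eq_zero_s10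
      (fun z hz => hsimple z ((hZ z).2 hz))
      fun z hz => hP0 z i (hZT z ((hZ z).2 hz) i)) (hPdeg i)
  choose A hA hAP using fun i => mem_boundedCombination.1 (hPI i)
  have hvan := sum_piFinset_eval_div_eq_zero_s10 T (h := g * (Matrix.of A).det) (by
    refine (totalDegree_mul _ _).trans_lt ?_
    have := totalDegree_det_le (A := Matrix.of A) hA
    have hm : T.card - 1 = (m - 1) + (T.card - m) := by
      have : m ≠ 0 := by rintro rfl; simp at hg
      omega
    rw [hm, mul_add]
    omega)
  rw [← hvan]
  refine (Finset.sum_subset_zero_on_sdiff (fun z hz => Fintype.mem_piFinset.2 (hZT z hz))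
    (fun x hx => ?_) fun z hz => ?_)
  · rw [Finset.mem_sdiff, Fintype.mem_piFinset, hZ] at hx
    have hdet : eval x (Matrix.of A).det = 0 := by
      rw [RingHom.map_det]
      refine Matrix.exists_mulVec_eq_zero_iff.1 ⟨fun j => eval x (F j), fun h => hx.2 fun j =>
        congrFun h j, ?_⟩
      funext i
      have := congrArg (eval x) (hAP i)
      rw [hP0 x i (hx.1 i)] at this
      simpa [Matrix.mulVec, dotProduct] using this
    rw [map_mul, hdet, mul_zero, zero_div]
  · have hFz := (hZ z).1 hz
    have hjac : ((eval z).mapMatrix (Matrix.of A)) * jacobianAt F z =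
        Matrix.diagonal fun i => ∏ t ∈ T.erase (z i), (z i - t) := by
      ext i l
      have h1 : eval z (pderiv l (P i)) = ∑ j, eval z (A i j) * eval z (pderiv l (F j)) := by
        rw [← hAP i]
        simp [Derivation.leibniz, hFz]
      have h2 : eval z (pderiv l (P i)) =
          Matrix.diagonal (fun i => ∏ t ∈ T.erase (z i), (z i - t)) i l := by
        have h3 : eval z (Polynomial.aeval (X i) (Polynomial.derivative p)) =
            ∏ t ∈ T.erase (z i), (z i - t) := by
          rw [← aeval_eq_eval, ← Polynomial.aeval_algHom_apply]
          have := Lagrange.eval_nodal_derivative_eval_node_eq (v := id) (hZT z hz i)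
          rw [Lagrange.eval_nodal] at this
          simpa [Polynomial.aeval_def] using this
        rw [Derivation.map_aeval, smul_eq_mul, map_mul, h3, pderiv_X, Matrix.diagonal_apply]
        by_cases h : i = l
        · subst h; simp
        · simp [h]
      rw [← h2, h1]
      simp [Matrix.mul_apply, jacobianAt]
    have hdet := congrArg Matrix.det hjac
    rw [Matrix.det_mul, Matrix.det_diagonal, ← RingHom.map_det] at hdet
    have hne : eval z (Matrix.of A).det ≠ 0 := by
      intro h
      rw [h, zero_mul] at hdet
      obtain ⟨i, -, hi⟩ := Finset.prod_eq_zero_iff.1 hdet.symm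
      obtain ⟨t, ht, hzt⟩ := Finset.prod_eq_zero_iff.1 hi
      exact Finset.ne_of_mem_erase ht (sub_eq_zero.1 hzt).symm
    rw [← hdet, map_mul, mul_comm (eval z g), mul_div_mul_left _ _ hne]

end MvPolynomial

theorem det_jacobianAt_grad_sub_X {n : ℕ} (V : MvPolynomial (Fin n) ℂ) (z : Fin n → ℂ) :
    (jacobianAt (fun j => pderiv j V - X j) z).det = (hess V z - 1).det := by
  rw [← Matrix.det_transpose]
  congr 1
  ext i j
  simp [jacobianAt, hess, pderiv_X, Matrix.one_apply, Pi.single_apply, eq_comm]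

theorem hess_zero {n k : ℕ} (hk : 2 < k) {V : MvPolynomial (Fin n) ℂ} (hV : V.IsHomogeneous k) :
    hess V 0 = 0 := by
  ext i j
  have h : constantCoeff (pderiv i (pderiv j V)) = 0 :=
    hV.pderiv.pderiv.coeff_eq_zero (by simp; omega)
  simpa [hess, constantCoeff_eq] using h

theorem vecMul_hess_of_grad_eq {n k : ℕ} (hk : 0 < k) {V : MvPolynomial (Fin n) ℂ}
    (hV : V.IsHomogeneous k) {d : Fin n → ℂ} (hd : grad V d = d) :
    Matrix.vecMul d (hess V d) = ((k : ℂ) - 1) • d := by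
  funext j
  have h := congrArg (eval d) (hV.pderiv (i := j)).sum_X_mul_pderiv
  have hj : eval d (pderiv j V) = d j := congrFun hd j
  simp only [map_sum, map_mul, eval_X, hj, nsmul_eq_mul, Nat.cast_pred hk] at h
  simpa [Matrix.vecMul, dotProduct, hess] using h

theorem mem_roots_charpoly_of_vecMul {n : ℕ} {M : Matrix (Fin n) (Fin n) ℂ} {c : ℂ}
    {d : Fin n → ℂ} (hd : d ≠ 0) (h : Matrix.vecMul d M = c • d) : c ∈ M.charpoly.roots := by
  rw [Polynomial.mem_roots M.charpoly_monic.ne_zero, Polynomial.IsRoot, Matrix.eval_charpoly]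
  refine Matrix.exists_vecMul_eq_zero_iff.1 ⟨d, hd, ?_⟩
  rw [Matrix.vecMul_sub, h, sub_eq_zero]
  ext j
  simp [mul_comm]

theorem shiftedSpectrum_sum_and_esymm {n k : ℕ} (hk : 2 < k) {V : MvPolynomial (Fin n) ℂ}
    (hV : V.IsHomogeneous k) {d : Fin n → ℂ} (hd0 : d ≠ 0) (hd : grad V d = d) :
    (shiftedSpectrum k V d).sum = (hess V d).trace - n - ((k : ℂ) - 2) ∧
      ((k : ℂ) - 2) * (shiftedSpectrum k V d).esymm (n - 1) = (hess V d - 1).det := by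
  have hmem : (k : ℂ) - 2 ∈ (hess V d - 1).charpoly.roots := by
    refine mem_roots_charpoly_of_vecMul hd0 ?_
    rw [Matrix.vecMul_sub, vecMul_hess_of_grad_eq (by omega) hV hd, Matrix.vecMul_one]
    module
  have hcons : ((k : ℂ) - 2) ::ₘ shiftedSpectrum k V d = (hess V d - 1).charpoly.roots :=
    Multiset.cons_erase hmem
  have hcard : (shiftedSpectrum k V d).card = n - 1 := by
    have h := (IsAlgClosed.splits (hess V d - 1).charpoly).natDegree_eq_card_roots
    rw [Matrix.charpoly_natDegree_eq_dim, Fintype.card_fin, ← hcons, Multiset.card_cons] at h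
    omega
  have htrace := Matrix.trace_eq_sum_roots_charpoly (hess V d - 1)
  have hdet := Matrix.det_eq_prod_roots_charpoly (hess V d - 1)
  rw [← hcons, Multiset.sum_cons, Matrix.trace_sub, Matrix.trace_one, Fintype.card_fin] at htrace
  rw [← hcons, Multiset.prod_cons] at hdet
  refine ⟨by linear_combination -htrace, ?_⟩
  rw [hdet, ← hcard, Multiset.esymm, Multiset.powersetCard_self]
  simp

/-- First family of universal relations among the Darboux-point eigenvalues of a generic
homogeneous potential:
`Σ_{d∈S} τ₁(Λ(d))^r / τ_{n−1}(Λ(d)) = (k−2)·(−1)^{n−1}·(−n−(k−2))^r` for `r = 0,…,n−1`,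
where `S` is the set of normalized proper Darboux points (each projective Darboux point
contributing `k−2` elements of `S`). -/
theorem stmt10 {n k : ℕ} (hn : 2 ≤ n) (hk : 2 < k)
    (V : MvPolynomial (Fin n) ℂ) (hV : V.IsHomogeneous k)
    (hproper : ∀ d : Fin n → ℂ, grad V d = 0 → d = 0)
    (S : Set (Fin n → ℂ)) (hSdef : S = {d | d ≠ 0 ∧ grad V d = d})
    (hfin : S.Finite)
    (hsimple : ∀ d ∈ S, Matrix.det (hess V d - 1) ≠ 0) :
    ∀ r < n,
      ∑ d ∈ hfin.toFinset,
          (shiftedSpectrum k V d).sum ^ r / (shiftedSpectrum k V d).esymm (n - 1) =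
        ((k : ℂ) - 2) * (-1) ^ (n - 1) * (-(n : ℂ) - ((k : ℂ) - 2)) ^ r := by
  intro r hr
  subst hSdef
  let L : Fin n → MvPolynomial (Fin n) ℂ := fun j => pderiv j V
  let F : Fin n → MvPolynomial (Fin n) ℂ := fun j => L j - X j
  let g : MvPolynomial (Fin n) ℂ :=
    (∑ i, pderiv i (pderiv i V) - C ((n : ℂ) + ((k : ℂ) - 2))) ^ r
  have hgeval : ∀ z, eval z g = ((hess V z).trace - n - ((k : ℂ) - 2)) ^ r := fun z => by
    simp [g, hess, Matrix.trace, sub_sub]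
  have hgrad0 : grad V 0 = 0 := by
    funext i
    have h : constantCoeff (pderiv i V) = 0 := hV.pderiv.coeff_eq_zero (by simp; omega)
    simpa [grad, constantCoeff_eq] using h
  have h0S : (0 : Fin n → ℂ) ∉ hfin.toFinset := by simp
  have hzero : ∀ z, (∀ j, eval z (F j) = 0) ↔ grad V z = z := fun z => by
    simp [F, L, grad, _root_.funext_iff, sub_eq_zero]
  have hgdeg : g.totalDegree < Fintype.card (Fin n) * (k - 1 - 1) := by
    have hlin : (∑ i, pderiv i (pderiv i V) - C ((n : ℂ) + ((k : ℂ) - 2))).totalDegree ≤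
        k - 1 - 1 :=
      (totalDegree_sub_C_le _ _).trans
        (totalDegree_finsetSum_le fun i _ => hV.pderiv.pderiv.totalDegree_le)
    rw [Fintype.card_fin]
    calc g.totalDegree ≤ r * (k - 1 - 1) :=
          (totalDegree_pow _ _).trans (Nat.mul_le_mul_left _ hlin)
      _ < n * (k - 1 - 1) := Nat.mul_lt_mul_of_pos_right hr (by omega)
  have hsum := sum_eval_div_det_jacobianAt_eq_zero (L := L) (F := F) (m := k - 1)
    (fun j => hV.pderiv) (fun x hx => hproper x (funext hx))
    (fun j => by simp only [F, sub_sub_cancel, totalDegree_X]; omega)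
    (Z := insert 0 hfin.toFinset)
    (fun z => by
      rw [hzero, Finset.mem_insert, Set.Finite.mem_toFinset, Set.mem_ofPred_eq]
      constructor
      · rintro (rfl | h)
        exacts [hgrad0, h.2]
      · exact fun h => (em (z = 0)).imp_right fun h0 => ⟨h0, h⟩)
    (fun z hz => by
      rw [det_jacobianAt_grad_sub_X]
      rcases Finset.mem_insert.1 hz with rfl | hz
      · simp [hess_zero hk hV, Matrix.det_neg]
      · exact hsimple z (hfin.mem_toFinset.1 hz))
    hgdeg
  rw [Finset.sum_insert h0S, hgeval, det_jacobianAt_grad_sub_X, hess_zero hk hV, zero_sub,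
    Matrix.det_neg, Fintype.card_fin, Matrix.det_one, mul_one, Matrix.trace_zero, zero_sub] at hsum
  have hk2 : (k : ℂ) - 2 ≠ 0 := by
    rw [sub_ne_zero]
    exact_mod_cast hk.ne'
  have hterm : ∀ d ∈ hfin.toFinset,
      (shiftedSpectrum k V d).sum ^ r / (shiftedSpectrum k V d).esymm (n - 1) =
        ((k : ℂ) - 2) * (eval d g / (jacobianAt F d).det) := fun d hd => by
    obtain ⟨hd0, hd⟩ := hfin.mem_toFinset.1 hd
    obtain ⟨h1, h2⟩ := shiftedSpectrum_sum_and_esymm hk hV hd0 hd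
    rw [hgeval, det_jacobianAt_grad_sub_X, h1, ← h2, mul_div, mul_div_mul_left _ _ hk2]
  rw [Finset.sum_congr rfl hterm, ← Finset.mul_sum, eq_neg_of_add_eq_zero_right hsum]
  obtain ⟨N, rfl⟩ : ∃ N, n = N + 1 := ⟨n - 1, by omega⟩
  rcases neg_one_pow_eq_or ℂ N with h | h <;> simp [pow_succ, h, div_neg]
  ring
end
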